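/- The infinite series identity $\sum_{k=0}^{\infty}\Big(\frac{1}{4}\Big)^k\frac{((1)_k)^2}{(5/4)_k\,(7/4)_k}\cdot\frac{5+6k}{1+2k} = 6G$ holds. -/

import Mathlib

open scoped BigOperators

/-- The shifted factorial (Pochhammer symbol) `(x)_n = x (x+1) ⋯ (x+n-1)`. -/
noncomputable def poch (x : ℝ) (n : ℕ) : ℝ := ∏ i ∈ Finset.range n, (x + i)

/-- The harmonic numbers of order 2, `H_n^{(2)} = ∑_{j=1}^n 1/j²`. -/
noncomputable def H2 (n : ℕ) : ℝ := ∑ j ∈ Finset.range n, 1 / ((j : ℝ) + 1) ^ 2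

/-- The Dirichlet beta value `β(4) = ∑_{k≥0} (-1)^k/(1+2k)⁴`. -/
noncomputable def beta4 : ℝ := ∑' k : ℕ, (-1) ^ k / (1 + 2 * (k : ℝ)) ^ 4

/-- The Catalan constant `G = ∑_{k≥0} (-1)^k/(1+2k)²`. -/
noncomputable def catalanG : ℝ := ∑' k : ℕ, (-1) ^ k / (1 + 2 * (k : ℝ)) ^ 2

theorem poch_succ (x : ℝ) (n : ℕ) : poch x (n + 1) = poch x n * (x + n) := by
  simp [poch, Finset.prod_range_succ]

theorem poch_pos {x : ℝ} (hx : 0 < x) (n : ℕ) : 0 < poch x n :=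
  Finset.prod_pos fun _ _ => by positivity

theorem poch_three_halves_two_mul (n : ℕ) :
    poch (3/2) (2 * n) * (2 * n + 3/2) =
      3/2 * 4 ^ n * (poch (5/4) n * poch (7/4) n) := by
  induction n with
  | zero => simp [poch]
  | succ n ih =>
    rw [show 2 * (n + 1) = 2 * n + 1 + 1 by ring]
    simp only [poch_succ, pow_succ]
    push_cast
    linear_combination (2 * (n : ℝ) + 5/2) * (2 * n + 7/2) * ih

theorem poch_half_mul (k : ℕ) : poch (1/2) k * (2 * k + 1) = poch (3/2) k := by
  induction k with
  | zero => simp [poch]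
  | succ k ih =>
    simp only [poch_succ]
    push_cast
    linear_combination ((k : ℝ) + 3/2) * ih

/-- The Wilf–Zeilberger kernel, without its alternating sign. -/
noncomputable def wzAbs (n k : ℕ) : ℝ :=
  poch 1 n ^ 2 * poch (1/2) k / (poch (3/2) (2 * n + k) * (2 * n + 2 * k + 1))

/-- The first member of the Wilf–Zeilberger pair. -/
noncomputable def wzF (n k : ℕ) : ℝ := (-1) ^ k * wzAbs n k

/-- The second member of the Wilf–Zeilberger pair. -/
noncomputable def wzG (n k : ℕ) : ℝ :=
  wzF n k * ((2 * k + 6 * n + 5) / (4 * (2 * n + k + 3/2)))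

theorem wzAbs_pos (n k : ℕ) : 0 < wzAbs n k := by
  have h₁ := poch_pos (x := 1) (by norm_num) n
  have h₂ := poch_pos (x := 1/2) (by norm_num) k
  have h₃ := poch_pos (x := 3/2) (by norm_num) (2 * n + k)
  unfold wzAbs
  positivity

theorem wzAbs_zero (k : ℕ) : wzAbs 0 k = 1 / (1 + 2 * (k : ℝ)) ^ 2 := by
  have h := poch_pos (x := 1/2) (by norm_num) k
  have hk : (2 * (k : ℝ) + 1) ≠ 0 := by positivity
  have hk' : (1 + 2 * (k : ℝ)) ≠ 0 := by positivity
  simp only [wzAbs, Nat.mul_zero, Nat.zero_add, ← poch_half_mul]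
  simp only [poch, Finset.range_zero, Finset.prod_empty, Nat.cast_zero] at h ⊢
  field_simp
  ring

theorem wzAbs_succ_left (n k : ℕ) :
    wzAbs (n + 1) k = wzAbs n k * ((n + 1) ^ 2 * (2 * n + 2 * k + 1) /
      ((2 * n + k + 3/2) * (2 * n + k + 5/2) * (2 * n + 2 * k + 3))) := by
  have h₃ := (poch_pos (x := 3/2) (by norm_num) (2 * n + k)).ne'
  have a₁ : (2 * (n : ℝ) + 2 * k + 1) ≠ 0 := by positivity
  have a₂ : (2 * (n : ℝ) + 2 * k + 3) ≠ 0 := by positivity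
  have a₃ : (2 * (n : ℝ) + k + 3/2) ≠ 0 := by positivity
  have a₄ : (2 * (n : ℝ) + k + 5/2) ≠ 0 := by positivity
  unfold wzAbs
  rw [show 2 * (n + 1) + k = 2 * n + k + 1 + 1 by ring]
  simp only [poch_succ]
  push_cast
  rw [show (3/2 + (2 * (n : ℝ) + k)) = 2 * n + k + 3/2 by ring,
    show (3/2 + (2 * (n : ℝ) + k + 1)) = 2 * n + k + 5/2 by ring,
    show (2 * ((n : ℝ) + 1) + 2 * k + 1) = 2 * n + 2 * k + 3 by ring, div_mul_div_comm,
    div_eq_div_iff (by positivity) (by positivity)]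
  ring

theorem wzAbs_succ_right (n k : ℕ) :
    wzAbs n (k + 1) = wzAbs n k * ((k + 1/2) * (2 * n + 2 * k + 1) /
      ((2 * n + k + 3/2) * (2 * n + 2 * k + 3))) := by
  have h₃ := (poch_pos (x := 3/2) (by norm_num) (2 * n + k)).ne'
  have a₁ : (2 * (n : ℝ) + 2 * k + 1) ≠ 0 := by positivity
  have a₂ : (2 * (n : ℝ) + 2 * k + 3) ≠ 0 := by positivity
  have a₃ : (2 * (n : ℝ) + k + 3/2) ≠ 0 := by positivity
  unfold wzAbs
  rw [show 2 * n + (k + 1) = 2 * n + k + 1 by ring]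
  simp only [poch_succ]
  push_cast
  rw [show (3/2 + (2 * (n : ℝ) + k)) = 2 * n + k + 3/2 by ring,
    show (2 * (n : ℝ) + 2 * (k + 1) + 1) = 2 * n + 2 * k + 3 by ring, div_mul_div_comm,
    div_eq_div_iff (by positivity) (by positivity)]
  ring

theorem wzF_sub_eq_wzG_sub (n k : ℕ) :
    wzF n k - wzF (n + 1) k = wzG n k - wzG n (k + 1) := by
  have key : 1 - (n + 1) ^ 2 * (2 * n + 2 * k + 1) /
      ((2 * n + k + 3/2) * (2 * n + k + 5/2) * (2 * n + 2 * k + 3)) =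
      (2 * k + 6 * n + 5) / (4 * (2 * n + k + 3/2)) +
      (k + 1/2) * (2 * n + 2 * k + 1) / ((2 * n + k + 3/2) * (2 * n + 2 * k + 3)) *
        ((2 * k + 6 * n + 7) / (4 * (2 * n + k + (5/2 : ℝ)))) := by
    rw [one_sub_div (by positivity), div_mul_div_comm, div_add_div _ _ (by positivity)
      (by positivity), div_eq_div_iff (by positivity) (by positivity)]
    ring
  unfold wzG wzF
  rw [wzAbs_succ_left, wzAbs_succ_right]
  push_cast
  rw [show (2 * ((k : ℝ) + 1) + 6 * n + 5) = 2 * k + 6 * n + 7 by ring,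
    show (2 * (n : ℝ) + (k + 1) + 3/2) = 2 * n + k + 5/2 by ring, pow_succ]
  linear_combination (-1) ^ k * wzAbs n k * key

theorem wzAbs_le (n k : ℕ) : wzAbs n k ≤ (1/2) ^ n * (1 / (1 + 2 * (k : ℝ)) ^ 2) := by
  induction n with
  | zero => simp [wzAbs_zero]
  | succ n ih =>
    have hr : ((n : ℝ) + 1) ^ 2 * (2 * n + 2 * k + 1) /
        ((2 * n + k + 3/2) * (2 * n + k + 5/2) * (2 * n + 2 * k + 3)) ≤ 1/2 := by
      rw [div_le_iff₀ (by positivity)]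
      have hn : (0 : ℝ) ≤ n := n.cast_nonneg
      have hk : (0 : ℝ) ≤ k := k.cast_nonneg
      have h₁ : ((n : ℝ) + 1) ^ 2 ≤ 1/2 * ((2 * n + k + 3/2) * (2 * n + k + 5/2)) := by
        nlinarith [mul_nonneg hn hk]
      calc ((n : ℝ) + 1) ^ 2 * (2 * n + 2 * k + 1)
          ≤ 1/2 * ((2 * n + k + 3/2) * (2 * n + k + 5/2)) * (2 * n + 2 * k + 3) := by
            gcongr
            norm_num
        _ = _ := by ring
    rw [wzAbs_succ_left]
    calc _ ≤ (1/2) ^ n * (1 / (1 + 2 * (k : ℝ)) ^ 2) * (1/2) := by gcongr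
      _ = _ := by ring

theorem norm_wzF (n k : ℕ) : ‖wzF n k‖ = wzAbs n k := by
  simp [wzF, abs_of_pos (wzAbs_pos n k)]

theorem norm_wzG_le (n k : ℕ) : ‖wzG n k‖ ≤ (1/2) ^ n * (1 / (1 + 2 * (k : ℝ)) ^ 2) := by
  refine le_trans ?_ (wzAbs_le n k)
  rw [wzG, norm_mul, norm_wzF]
  refine mul_le_of_le_one_right (wzAbs_pos n k).le ?_
  rw [Real.norm_of_nonneg (by positivity), div_le_one (by positivity)]
  have hn : (0 : ℝ) ≤ n := n.cast_nonneg
  have hk : (0 : ℝ) ≤ k := k.cast_nonneg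
  linarith

theorem summable_one_div_odd_sq : Summable fun k : ℕ => 1 / (1 + 2 * (k : ℝ)) ^ 2 := by
  have h := (summable_nat_add_iff 1).2 (Real.summable_one_div_nat_pow.2 one_lt_two)
  refine h.of_nonneg_of_le (fun k => by positivity) fun k => ?_
  push_cast
  have hk : (0 : ℝ) ≤ k := k.cast_nonneg
  gcongr 1 / ?_ ^ 2
  linarith

theorem summable_wzF (n : ℕ) : Summable (wzF n) :=
  (summable_one_div_odd_sq.mul_left ((1/2) ^ n)).of_norm_bounded
    fun k => (norm_wzF n k).trans_le (wzAbs_le n k)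

theorem tsum_wzF_sub (n : ℕ) : ∑' k, wzF n k - ∑' k, wzF (n + 1) k = wzG n 0 := by
  rw [← (summable_wzF n).tsum_sub (summable_wzF (n + 1))]
  have hs := ((summable_wzF n).sub (summable_wzF (n + 1))).hasSum.tendsto_sum_nat
  refine tendsto_nhds_unique hs ?_
  simp only [wzF_sub_eq_wzG_sub, Finset.sum_range_sub']
  have hG : Summable (wzG n) :=
    (summable_one_div_odd_sq.mul_left ((1/2) ^ n)).of_norm_bounded (norm_wzG_le n)
  simpa using hG.tendsto_atTop_zero.const_sub (wzG n 0)

theorem tendsto_tsum_wzF :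
    Filter.Tendsto (fun n => ∑' k, wzF n k) Filter.atTop (nhds 0) := by
  have h := (tendsto_pow_atTop_nhds_zero_of_lt_one (r := (1/2 : ℝ)) (by norm_num)
    (by norm_num)).mul_const (∑' k : ℕ, 1 / (1 + 2 * (k : ℝ)) ^ 2)
  rw [zero_mul] at h
  refine squeeze_zero_norm (fun n => ?_) h
  rw [← tsum_mul_left]
  exact tsum_of_norm_bounded (summable_one_div_odd_sq.mul_left ((1/2) ^ n)).hasSum
    fun k => (norm_wzF n k).trans_le (wzAbs_le n k)

theorem tsum_wzG_zero : ∑' n, wzG n 0 = catalanG := by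
  have hG : Summable fun n => wzG n 0 :=
    (summable_geometric_of_lt_one (r := (1/2 : ℝ)) (by norm_num)
      (by norm_num)).of_norm_bounded fun n => by simpa using norm_wzG_le n 0
  have h₀ : ∑' k, wzF 0 k = catalanG :=
    tsum_congr fun k => by rw [wzF, wzAbs_zero, mul_one_div]
  refine tendsto_nhds_unique hG.hasSum.tendsto_sum_nat ?_
  simp only [← tsum_wzF_sub, Finset.sum_range_sub' fun n => ∑' k, wzF n k, h₀]
  simpa using tendsto_tsum_wzF.const_sub catalanG

theorem six_mul_wzG_zero (k : ℕ) :
    (1/4 : ℝ) ^ k * (poch 1 k ^ 2 / (poch (5/4) k * poch (7/4) k)) *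
      ((5 + 6 * (k : ℝ)) / (1 + 2 * (k : ℝ))) = 6 * wzG k 0 := by
  have h₁ := poch_pos (x := 5/4) (by norm_num) k
  have h₂ := poch_pos (x := 7/4) (by norm_num) k
  have h₃ := poch_pos (x := 3/2) (by norm_num) (2 * k)
  have h := poch_three_halves_two_mul k
  have hp : poch (1/2) 0 = 1 := by simp [poch]
  have hG : 6 * wzG k 0 = 3/2 * (poch 1 k ^ 2 * (6 * k + 5)) /
      (poch (3/2) (2 * k) * (2 * k + 3/2) * (2 * k + 1)) := by
    simp only [wzG, wzF, wzAbs, hp, Nat.cast_zero, mul_zero, add_zero, pow_zero, one_mul, mul_one,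
      zero_add]
    rw [div_mul_div_comm, mul_div_assoc', div_eq_div_iff (by positivity) (by positivity)]
    ring
  rw [hG, h, one_div_pow, div_mul_div_comm, div_mul_div_comm,
    div_eq_div_iff (by positivity) (by positivity)]
  ring

theorem stmt13 :
    (∑' k : ℕ, (1/4 : ℝ) ^ k * (poch 1 k ^ 2 / (poch (5/4) k * poch (7/4) k)) *
      ((5 + 6 * (k : ℝ)) / (1 + 2 * (k : ℝ)))) = 6 * catalanG := by
  rw [tsum_congr six_mul_wzG_zero, tsum_mul_left, tsum_wzG_zero]
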